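/- Let N ≥ 5 be an integer and a, b, A > 0 real numbers. Consider the function f(s) = 1 - b·A·s^(4-N) - a·s² on (0, ∞). If ((N-4)·b·A/2)^(2/(N-2)) · ((N-2)/(N-4)) · a^((N-4)/(N-2)) < 1, then there exist exactly two values 0 < s₁ < s₂ with f(s₁) = f(s₂) = 0; moreover f(s) < 0 for 0 < s < s₁, f(s) > 0 for s₁ < s < s₂, and f(s) < 0 for s > s₂. -/

import Mathlib

open Set

/-- A strictly concave function on the positive half-line that is negative, then positive, then
negative again has exactly two zeros there, and they separate its sign regions. -/
lemma StrictConcaveOn.exists_two_zeros_and_signs {f : ℝ → ℝ} (hf : StrictConcaveOn ℝ (Ioi 0) f)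
    {p c q : ℝ} (hp : 0 < p) (hpc : p < c) (hcq : c < q) (hfp : f p < 0) (hfc : 0 < f c)
    (hfq : f q < 0) :
    ∃ s₁ s₂ : ℝ, 0 < s₁ ∧ s₁ < s₂ ∧ f s₁ = 0 ∧ f s₂ = 0 ∧
      (∀ s : ℝ, 0 < s → f s = 0 → s = s₁ ∨ s = s₂) ∧
      (∀ s : ℝ, 0 < s → s < s₁ → f s < 0) ∧
      (∀ s : ℝ, s₁ < s → s < s₂ → 0 < f s) ∧
      (∀ s : ℝ, s₂ < s → f s < 0) := by
  have hcont : ContinuousOn f (Ioi 0) := hf.concaveOn.continuousOn isOpen_Ioi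
  obtain ⟨s₁, ⟨hps₁, hs₁c⟩, hs₁⟩ := intermediate_value_Ioo hpc.le
    (hcont.mono fun x hx => lt_of_lt_of_le hp hx.1) ⟨hfp, hfc⟩
  obtain ⟨s₂, ⟨hcs₂, hs₂q⟩, hs₂⟩ := intermediate_value_Ioo' hcq.le
    (hcont.mono fun x hx => lt_of_lt_of_le (hp.trans hpc) hx.1) ⟨hfq, hfc⟩
  have h₁ : 0 < s₁ := hp.trans hps₁
  have h₁₂ : s₁ < s₂ := hs₁c.trans hcs₂
  have h₂ : 0 < s₂ := h₁.trans h₁₂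
  have left (s : ℝ) (hs : 0 < s) (hss : s < s₁) : f s < 0 := by
    have h := hf.slope_anti_adjacent (mem_Ioi.2 hs) (mem_Ioi.2 h₂) hss h₁₂
    rw [hs₁, hs₂, sub_self, zero_div, div_pos_iff_of_pos_right (sub_pos.2 hss)] at h
    linarith
  have middle (s : ℝ) (hs₁s : s₁ < s) (hss₂ : s < s₂) : 0 < f s := by
    have h := hf.slope_anti_adjacent (mem_Ioi.2 h₁) (mem_Ioi.2 h₂) hs₁s hss₂
    rw [hs₁, hs₂] at h
    by_contra! hle
    have hr : (f s - 0) / (s - s₁) ≤ 0 :=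
      div_nonpos_of_nonpos_of_nonneg (by linarith) (by linarith)
    have hl : 0 ≤ (0 - f s) / (s₂ - s) := div_nonneg (by linarith) (by linarith)
    linarith
  have right (s : ℝ) (hss : s₂ < s) : f s < 0 := by
    have h := hf.slope_anti_adjacent (mem_Ioi.2 h₁) (mem_Ioi.2 (h₂.trans hss)) h₁₂ hss
    rw [hs₁, hs₂, sub_self, zero_div, div_lt_iff₀ (sub_pos.2 hss), zero_mul] at h
    linarith
  refine ⟨s₁, s₂, h₁, h₁₂, hs₁, hs₂, fun s hs hfs => ?_, left, middle, right⟩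
  by_contra! hne
  rcases lt_or_gt_of_ne hne.1 with h | h
  · exact (left s hs h).ne hfs
  rcases lt_or_gt_of_ne hne.2 with h' | h'
  · exact (middle s h h').ne' hfs
  · exact (right s h').ne hfs

lemma strictConcaveOn_one_sub_zpow_sub_sq {a B : ℝ} (ha : 0 < a) (hB : 0 ≤ B) (k : ℤ) :
    StrictConcaveOn ℝ (Ioi 0) fun s : ℝ => 1 - B * s ^ k - a * s ^ 2 := by
  have hz : ConvexOn ℝ (Ioi 0) fun s : ℝ => B * s ^ k := (convexOn_zpow k).smul hB
  have hsq : StrictConvexOn ℝ (Ioi 0) fun s : ℝ => s ^ 2 :=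
    (even_two.strictConvexOn_pow two_pos.ne').subset (subset_univ _) (convex_Ioi 0)
  have hsq' : StrictConvexOn ℝ (Ioi 0) fun s : ℝ => a * s ^ 2 := by
    refine ⟨convex_Ioi 0, fun x hx y hy hxy u v hu hv huv => ?_⟩
    have h := mul_lt_mul_of_pos_left (hsq.2 hx hy hxy hu hv huv) ha
    simp only [smul_eq_mul] at h ⊢
    linarith
  exact ((concaveOn_const 1 (convex_Ioi 0)).sub hz).sub_strictConvexOn hsq'

/-- The maximal value of `1 - B s ^ (-m) - a s ^ 2` over `s > 0`, attained at
`s ^ (m + 2) = m B / (2 a)`. -/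
lemma exists_pos_one_sub_zpow_sub_sq_eq {a B : ℝ} (ha : 0 < a) (hB : 0 < B) {m : ℕ} (hm : 0 < m) :
    ∃ s : ℝ, 0 < s ∧ 1 - B * s ^ (-(m : ℤ)) - a * s ^ 2 =
      1 - (m * B / 2) ^ ((2 : ℝ) / (m + 2)) * ((m + 2) / m) * a ^ ((m : ℝ) / (m + 2)) := by
  have hm' : (0 : ℝ) < m := by exact_mod_cast hm
  have hC : 0 < m * B / 2 := by positivity
  set C := m * B / 2 with hCdef
  have hs : 0 < (C / a) ^ ((1 : ℝ) / (m + 2)) := by positivity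
  refine ⟨(C / a) ^ ((1 : ℝ) / (m + 2)), hs, ?_⟩
  have hpow : ((C / a) ^ ((1 : ℝ) / (m + 2))) ^ (m + 2) = C / a := by
    rw [← Real.rpow_natCast, ← Real.rpow_mul (by positivity)]
    push_cast
    rw [one_div_mul_cancel (by positivity), Real.rpow_one]
  have hsq : a * ((C / a) ^ ((1 : ℝ) / (m + 2))) ^ 2 =
      C ^ ((2 : ℝ) / (m + 2)) * a ^ ((m : ℝ) / (m + 2)) := by
    rw [← Real.rpow_natCast, ← Real.rpow_mul (by positivity), Real.div_rpow hC.le ha.le]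
    have he : (m : ℝ) / (m + 2) = 1 - 1 / (m + 2) * (2 : ℕ) := by
      push_cast
      field_simp
      ring
    rw [he, Real.rpow_sub ha, Real.rpow_one,
      show (2 : ℝ) / (m + 2) = 1 / (m + 2) * (2 : ℕ) by push_cast; ring]
    ring
  set s := (C / a) ^ ((1 : ℝ) / (m + 2))
  have hz : B * s ^ (-(m : ℤ)) = 2 / m * (a * s ^ 2) := by
    rw [zpow_neg, zpow_natCast]
    rw [pow_add, eq_div_iff ha.ne'] at hpow
    field_simp
    linarith
  rw [hz, mul_right_comm, ← hsq]
  field_simp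
  ring

lemma one_le_mul_zpow_neg {B s : ℝ} (hs : 0 < s) (hs1 : s ≤ 1) (hsB : s ≤ B) {m : ℕ} (hm : 0 < m) :
    1 ≤ B * s ^ (-(m : ℤ)) := by
  rw [zpow_neg, zpow_natCast, ← div_eq_mul_inv, one_le_div (pow_pos hs m)]
  exact (pow_le_of_le_one hs.le hs1 hm.ne').trans hsB

theorem stmt_0 (N : ℕ) (hN : 5 ≤ N) (a b A : ℝ) (ha : 0 < a) (hb : 0 < b) (hA : 0 < A)
    (f : ℝ → ℝ) (hf : ∀ s : ℝ, f s = 1 - b * A * s ^ ((4 : ℤ) - N) - a * s ^ 2)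
    (hthr : (((N : ℝ) - 4) * b * A / 2) ^ ((2 : ℝ) / ((N : ℝ) - 2)) *
      (((N : ℝ) - 2) / ((N : ℝ) - 4)) * a ^ (((N : ℝ) - 4) / ((N : ℝ) - 2)) < 1) :
    ∃ s₁ s₂ : ℝ, 0 < s₁ ∧ s₁ < s₂ ∧ f s₁ = 0 ∧ f s₂ = 0 ∧
      (∀ s : ℝ, 0 < s → f s = 0 → s = s₁ ∨ s = s₂) ∧
      (∀ s : ℝ, 0 < s → s < s₁ → f s < 0) ∧
      (∀ s : ℝ, s₁ < s → s < s₂ → 0 < f s) ∧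
      (∀ s : ℝ, s₂ < s → f s < 0) := by
  obtain ⟨m, rfl⟩ := Nat.exists_eq_add_of_le' (show 4 ≤ N by omega)
  have hm : 0 < m := by omega
  have hB : 0 < b * A := mul_pos hb hA
  have hk : (4 : ℤ) - (m + 4 : ℕ) = -(m : ℤ) := by push_cast; ring
  rw [hk] at hf
  have h4 : ((m + 4 : ℕ) : ℝ) - 4 = m := by push_cast; ring
  have h2 : ((m + 4 : ℕ) : ℝ) - 2 = m + 2 := by push_cast; ring
  rw [h4, h2, mul_assoc (m : ℝ) b A] at hthr
  obtain ⟨c, hc, hmax⟩ := exists_pos_one_sub_zpow_sub_sq_eq ha hB hm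
  have hfc : 0 < f c := by rw [hf, hmax]; linarith
  have hconc : StrictConcaveOn ℝ (Ioi 0) f :=
    (funext hf : f = _) ▸ strictConcaveOn_one_sub_zpow_sub_sq ha hB.le _
  have small (s : ℝ) (hs : 0 < s) (hsp : s ≤ min 1 (b * A)) : f s < 0 := by
    have h := one_le_mul_zpow_neg hs (hsp.trans (min_le_left _ _)) (hsp.trans (min_le_right _ _)) hm
    have : 0 < a * s ^ 2 := by positivity
    rw [hf]
    linarith
  have large (s : ℝ) (hs : 0 < s) (hsq : √a⁻¹ ≤ s) : f s < 0 := by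
    have h : 1 ≤ a * s ^ 2 := (inv_le_iff_one_le_mul₀' ha).1 ((Real.sqrt_le_left hs.le).1 hsq)
    have : 0 < b * A * s ^ (-(m : ℤ)) := by positivity
    rw [hf]
    linarith
  have hp : 0 < min 1 (b * A) := lt_min one_pos hB
  have hq : 0 < √a⁻¹ := by positivity
  exact hconc.exists_two_zeros_and_signs hp (lt_of_not_ge fun h => (small c hc h).not_gt hfc)
    (lt_of_not_ge fun h => (large c hc h).not_gt hfc) (small _ hp le_rfl) hfc (large _ hq le_rfl)
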